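/- Let h ≥ 2, ℓ ≥ 2, and s ≥ 1 be integers, and let A be an infinite B_{h−1,s}-set of nonnegative integers. If r_{A,h}(n) ≥ ℓ for all sufficiently large integers n in the sumset hA, then there is a positive real number w₀ such that A(x) > (ℓ − 1)(log x)/(s · log h) − w₀ for all real x ≥ h. -/

import Mathlib

/-- The representation function `r_{A,h}(n)`: the number of nondecreasing
`h`-tuples `(a₁,…,a_h)` of elements of `A` with `a₁ + ⋯ + a_h = n`. -/
noncomputable def rep (A : Set ℕ) (h n : ℕ) : ℕ :=
  Set.ncard {f : Fin h → ℕ | (∀ i, f i ∈ A) ∧ Monotone f ∧ ∑ i, f i = n}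

/-- The `h`-fold sumset `hA`: all sums of `h` not necessarily distinct elements of `A`. -/
def sumset (A : Set ℕ) (h : ℕ) : Set ℕ :=
  {n | ∃ f : Fin h → ℕ, (∀ i, f i ∈ A) ∧ ∑ i, f i = n}

/-- The counting function `A(x)`: the number of `a ∈ A` with `1 ≤ a ≤ x`. -/
noncomputable def count (A : Set ℕ) (x : ℝ) : ℕ :=
  Set.ncard {a : ℕ | a ∈ A ∧ 1 ≤ a ∧ (a : ℝ) ≤ x}

/-- The set of representations counted by `rep` is finite. -/
lemma finite_representations (A : Set ℕ) (h n : ℕ) :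
    {f : Fin h → ℕ | (∀ i, f i ∈ A) ∧ Monotone f ∧ ∑ i, f i = n}.Finite := by
  refine (Set.finite_Iic (fun _ : Fin h => n)).subset ?_
  rintro f ⟨-, -, hf⟩ i
  rw [← hf]
  exact Finset.single_le_sum (f := f) (fun _ _ => Nat.zero_le _) (Finset.mem_univ i)

/-- A nonconstant monotone tuple with sum `(k + 1) * a` has its last entry above `a`. -/
lemma lt_last_of_sum_eq {k a : ℕ} {f : Fin (k + 1) → ℕ} (hmono : Monotone f)
    (hsum : ∑ i, f i = (k + 1) * a) (hne : f ≠ fun _ => a) : a < f (Fin.last k) := by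
  by_contra hlt
  have hle : ∀ i ∈ Finset.univ, f i ≤ a := fun i _ =>
    (hmono (Fin.le_last i)).trans (not_lt.mp hlt)
  have heq := (Finset.sum_eq_sum_iff_of_le hle).mp (by simp [hsum])
  exact hne (funext fun i => heq i (Finset.mem_univ i))

/-- In a `B_{k,s}`-set, at most `s` of the representations of `n` as a sum of `k + 1` elements
have a given largest element. -/
lemma ncard_representations_last_le {A : Set ℕ} {k s : ℕ}
    (hB : ∀ n ∈ sumset A k, rep A k n ≤ s) (n m : ℕ) :
    {f : Fin (k + 1) → ℕ | ((∀ i, f i ∈ A) ∧ Monotone f ∧ ∑ i, f i = n) ∧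
      f (Fin.last k) = m}.ncard ≤ s := by
  set F := {f : Fin (k + 1) → ℕ | ((∀ i, f i ∈ A) ∧ Monotone f ∧ ∑ i, f i = n) ∧
    f (Fin.last k) = m}
  have hmaps : ∀ f ∈ F, Fin.init f ∈
      {g : Fin k → ℕ | (∀ i, g i ∈ A) ∧ Monotone g ∧ ∑ i, g i = n - m} := by
    rintro f ⟨⟨hfA, hmono, hsum⟩, hlast⟩
    refine ⟨fun i => hfA _, fun i j hij => hmono (by simpa using hij), ?_⟩
    rw [Fin.sum_univ_castSucc, hlast] at hsum
    simp only [Fin.init]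
    omega
  rcases F.eq_empty_or_nonempty with hempty | ⟨f, hf⟩
  · simp [hempty]
  · have hmem : n - m ∈ sumset A k :=
      ⟨Fin.init f, (hmaps f hf).1, (hmaps f hf).2.2⟩
    refine le_trans (Set.ncard_le_ncard_of_injOn Fin.init hmaps ?_
      (finite_representations A k (n - m))) (hB _ hmem)
    rintro f ⟨-, hf⟩ g ⟨-, hg⟩ hfg
    rw [← Fin.snoc_init_self f, ← Fin.snoc_init_self g, hfg, hf, hg]

/-- If `(k + 1) * a` has at least `ℓ` representations, then `A` has at least `(ℓ - 1) / s`
elements in the interval `(a, (k + 1) * a]`. -/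
lemma le_mul_ncard_inter_Ioc {A : Set ℕ} {k s ℓ a : ℕ}
    (hB : ∀ n ∈ sumset A k, rep A k n ≤ s) (hrep : ℓ ≤ rep A (k + 1) ((k + 1) * a)) :
    ℓ - 1 ≤ s * (A ∩ Set.Ioc a ((k + 1) * a)).ncard := by
  classical
  have hfin := finite_representations A (k + 1) ((k + 1) * a)
  have hT : (A ∩ Set.Ioc a ((k + 1) * a)).Finite := (Set.finite_Ioc _ _).inter_of_right A
  have hcard : ℓ - 1 ≤ (hfin.toFinset.erase fun _ => a).card := by
    have herase := Finset.pred_card_le_card_erase (s := hfin.toFinset) (a := fun _ => a)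
    rw [← Set.ncard_eq_toFinset_card _ hfin] at herase
    exact (Nat.sub_le_sub_right hrep 1).trans herase
  rw [Set.ncard_eq_toFinset_card _ hT]
  refine hcard.trans (Finset.card_le_mul_card_image_of_maps_to
    (f := fun f : Fin (k + 1) → ℕ => f (Fin.last k)) ?_ s ?_)
  · intro f hf
    simp only [Finset.mem_erase, Set.Finite.mem_toFinset, Set.mem_ofPred_eq] at hf
    obtain ⟨hne, hfA, hmono, hsum⟩ := hf
    rw [Set.Finite.mem_toFinset]
    refine ⟨hfA _, lt_last_of_sum_eq hmono hsum hne, ?_⟩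
    rw [← hsum]
    exact Finset.single_le_sum (f := f) (fun _ _ => Nat.zero_le _) (Finset.mem_univ _)
  · intro m _
    refine le_trans ?_ (ncard_representations_last_le hB ((k + 1) * a) m)
    rw [← Set.ncard_coe_finset]
    refine Set.ncard_le_ncard ?_ (hfin.subset fun f hf => hf.1)
    intro f hf
    simp only [Finset.coe_filter, Finset.mem_erase, Set.Finite.mem_toFinset,
      Set.mem_ofPred_eq] at hf
    exact ⟨hf.1.2, hf.2⟩

lemma finite_count_set (A : Set ℕ) (x : ℝ) :
    {a : ℕ | a ∈ A ∧ 1 ≤ a ∧ (a : ℝ) ≤ x}.Finite :=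
  (Set.finite_Iic ⌊x⌋₊).subset fun _ ha => Nat.le_floor ha.2.2

lemma count_mono (A : Set ℕ) : Monotone (count A) := fun _ y hxy =>
  Set.ncard_le_ncard (fun _ ha => ⟨ha.1, ha.2.1, ha.2.2.trans hxy⟩) (finite_count_set A y)

/-- The elements of `A` in `(N, M]` are counted by `count A M` but not by `count A N`. -/
lemma count_add_ncard_inter_Ioc_le (A : Set ℕ) {N M : ℕ} (hNM : N ≤ M) :
    count A N + (A ∩ Set.Ioc N M).ncard ≤ count A M := by
  unfold count
  rw [← Set.ncard_union_eq ?_ (finite_count_set A N) ((Set.finite_Ioc _ _).inter_of_right A)]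
  · refine Set.ncard_le_ncard ?_ (finite_count_set A M)
    rintro a (⟨haA, ha1, haN⟩ | ⟨haA, haN, haM⟩)
    · exact ⟨haA, ha1, haN.trans (by exact_mod_cast hNM)⟩
    · exact ⟨haA, by omega, by exact_mod_cast haM⟩
  · rw [Set.disjoint_left]
    rintro a ⟨-, -, haN⟩ ⟨-, haN', -⟩
    exact absurd (Nat.cast_le.mp haN) (not_le.mpr haN')

/-- Passing from `N` to `(k + 1) * N` increases `s * A(N)` by at least `ℓ - 1`, once `N` is at
least some element `b` of `A` beyond which all diagonal sums have `ℓ` representations. -/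
lemma mul_count_add_le {A : Set ℕ} {k s ℓ b N : ℕ} (hB : ∀ n ∈ sumset A k, rep A k n ≤ s)
    (hrep : ∀ a ∈ A, b ≤ a → ℓ ≤ rep A (k + 1) ((k + 1) * a)) (hb : b ∈ A) (hbN : b ≤ N) :
    s * count A N + (ℓ - 1) ≤ s * count A ((k + 1) * N : ℕ) := by
  obtain ⟨a, ⟨haA, haN⟩, hmax⟩ := Set.exists_max_image (A ∩ Set.Iic N) id
    ((Set.finite_Iic N).inter_of_right A) ⟨b, hb, hbN⟩
  have hsub : A ∩ Set.Ioc a ((k + 1) * a) ⊆ A ∩ Set.Ioc N ((k + 1) * N) := by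
    rintro c ⟨hcA, hac, hca⟩
    refine ⟨hcA, ?_, hca.trans (Nat.mul_le_mul_left _ haN)⟩
    by_contra hcN
    exact absurd (hmax c ⟨hcA, not_lt.mp hcN⟩) (not_le.mpr hac)
  calc s * count A N + (ℓ - 1)
      ≤ s * count A N + s * (A ∩ Set.Ioc N ((k + 1) * N)).ncard := by
        gcongr
        refine (le_mul_ncard_inter_Ioc hB (hrep a haA (hmax b ⟨hb, hbN⟩))).trans ?_
        gcongr
        exact (Set.finite_Ioc _ _).inter_of_right A
    _ = s * (count A N + (A ∩ Set.Ioc N ((k + 1) * N)).ncard) := by ring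
    _ ≤ _ := by
        gcongr
        exact count_add_ncard_inter_Ioc_le A (Nat.le_mul_of_pos_left N k.succ_pos)

theorem stmt_2 (h ℓ s : ℕ) (hh : 2 ≤ h) (hℓ : 2 ≤ ℓ) (hs : 1 ≤ s)
    (A : Set ℕ) (hA : A.Infinite)
    (hB : ∀ n ∈ sumset A (h - 1), rep A (h - 1) n ≤ s)
    (hr : ∃ n₀ : ℕ, ∀ n : ℕ, n₀ ≤ n → n ∈ sumset A h → ℓ ≤ rep A h n) :
    ∃ w₀ : ℝ, 0 < w₀ ∧ ∀ x : ℝ, (h : ℝ) ≤ x →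
      (count A x : ℝ) > ((ℓ : ℝ) - 1) * Real.log x / ((s : ℝ) * Real.log h) - w₀ := by
  obtain ⟨k, rfl⟩ : ∃ k, h = k + 1 := ⟨h - 1, by omega⟩
  rw [Nat.add_sub_cancel] at hB
  obtain ⟨n₀, hn₀⟩ := hr
  obtain ⟨b, hbA, hb⟩ := hA.exists_gt n₀
  have hrep : ∀ a ∈ A, b ≤ a → ℓ ≤ rep A (k + 1) ((k + 1) * a) := fun a ha hba =>
    hn₀ _ (by nlinarith) ⟨fun _ => a, fun _ => ha, by simp⟩
  have hgrow : ∀ j : ℕ, j * (ℓ - 1) ≤ s * count A ((k + 1) ^ j * b : ℕ) := by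
    intro j
    induction j with
    | zero => simp
    | succ j ih =>
      have hstep := mul_count_add_le hB hrep hbA
        (Nat.le_mul_of_pos_left b (pow_pos k.succ_pos j))
      rw [← mul_assoc, ← pow_succ'] at hstep
      linarith [add_mul j 1 (ℓ - 1)]
  have hb1 : (1 : ℝ) ≤ b := by exact_mod_cast (show 1 ≤ b by omega)
  have hs0 : (0 : ℝ) < s := by exact_mod_cast hs
  have hℓ1 : (0 : ℝ) < (ℓ : ℝ) - 1 := by
    have : (2 : ℝ) ≤ ℓ := by exact_mod_cast hℓ
    linarith
  have hbase : (1 : ℝ) < ((k + 1 : ℕ) : ℝ) := by exact_mod_cast (show 1 < k + 1 by omega)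
  have hlog : 0 < Real.log ((k + 1 : ℕ) : ℝ) := Real.log_pos hbase
  set L := Real.log ((k + 1 : ℕ) : ℝ)
  have hlogb : 0 ≤ Real.log b := Real.log_nonneg hb1
  refine ⟨((ℓ : ℝ) - 1) / s * (Real.log b / L + 1), by positivity, fun x hx => ?_⟩
  have hx0 : 0 < x := by linarith
  set y := (Real.log x - Real.log b) / L with hy
  have hbound : ((ℓ : ℝ) - 1) * Real.log x / ((s : ℝ) * L)
      - ((ℓ : ℝ) - 1) / s * (Real.log b / L + 1) = ((ℓ : ℝ) - 1) / s * (y - 1) := by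
    rw [hy]
    field_simp
    ring
  rw [hbound, gt_iff_lt]
  rcases lt_or_ge y 0 with hy0 | hy0
  · exact lt_of_lt_of_le (mul_neg_of_pos_of_neg (by positivity) (by linarith))
      (Nat.cast_nonneg _)
  · have hpow : (((k + 1) ^ ⌊y⌋₊ * b : ℕ) : ℝ) ≤ x := by
      have hfloor : (⌊y⌋₊ : ℝ) * L ≤ Real.log x - Real.log b :=
        (le_div_iff₀ hlog).mp (Nat.floor_le hy0)
      rw [Nat.cast_mul, Nat.cast_pow,
        ← Real.log_le_log_iff (by positivity) hx0, Real.log_mul (by positivity) (by positivity),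
        Real.log_pow]
      linarith
    have hcount : (⌊y⌋₊ : ℝ) * ((ℓ : ℝ) - 1) ≤ s * count A x := by
      have hnat := (hgrow ⌊y⌋₊).trans (Nat.mul_le_mul_left s (count_mono A hpow))
      rw [← Nat.cast_one, ← Nat.cast_sub (by omega : 1 ≤ ℓ)]
      exact_mod_cast hnat
    rw [div_mul_eq_mul_div, div_lt_iff₀ hs0]
    nlinarith [Nat.lt_floor_add_one y]
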